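/- Let n ≥ 2 be an integer, let r ≥ 1 and c ∈ ℝ with r² ≤ 2c. Then, with the convention x_{n+1} = x_1, the cyclic integral ∫_0^∞ dx_1 ∫_{(−∞,0]^{n−1}} dx_2⋯dx_n ∏_{i=1}^{n} Ai(x_i − x_{i+1} + 2c) is absolutely convergent and its absolute value is at most β^n. -/

import Mathlib

open MeasureTheory

/-- The Airy function, defined by an absolutely convergent contour integral
over the vertical line `Re w = 1`. -/
noncomputable def Ai (x : ℝ) : ℝ :=
  (1 / (2 * Real.pi)) *
    ∫ t : ℝ, (Complex.exp ((1 + (t : ℂ) * Complex.I) ^ 3 / 3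
      - (1 + (t : ℂ) * Complex.I) * (x : ℂ))).re

/-- The constant `β = max{2 e^{r³/3 - 2rc}, e^{(r-1/7)³/3 - 2(r-1/7)c}}`. -/
noncomputable def beta (r c : ℝ) : ℝ :=
  max (2 * Real.exp (r ^ 3 / 3 - 2 * r * c))
    (Real.exp ((r - 1 / 7) ^ 3 / 3 - 2 * (r - 1 / 7) * c))

theorem lintegral_pi_fin_succ {m : ℕ} {F : (Fin (m + 1) → ℝ) → ENNReal} (hF : Measurable F) :
    ∫⁻ x, F x = ∫⁻ t : ℝ, ∫⁻ y : Fin m → ℝ, F (Fin.cons t y) := by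
  have e := (volume_preserving_piFinSuccAbove (fun _ : Fin (m + 1) => ℝ) 0).symm
  rw [← e.lintegral_comp_emb (MeasurableEquiv.measurableEmbedding _) F, Measure.volume_eq_prod,
    lintegral_prod (fun p => F ((MeasurableEquiv.piFinSuccAbove _ 0).symm p))
      (hF.comp (MeasurableEquiv.measurable _)).aemeasurable]
  simp [MeasurableEquiv.piFinSuccAbove, Fin.insertNthEquiv]

theorem lintegral_chain {f ψ : ℝ → ENNReal} (hf : Measurable f) (hψ : Measurable ψ) (m : ℕ) :
    ∫⁻ x : Fin (m + 1) → ℝ, f (x 0) * ∏ i : Fin m, ψ (x i.castSucc - x i.succ)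
      = (∫⁻ t, f t) * (∫⁻ t, ψ t) ^ m := by
  induction m generalizing f with
  | zero =>
    rw [lintegral_pi_fin_succ (by fun_prop)]
    simp [volume_pi]
  | succ m ih =>
    rw [lintegral_pi_fin_succ (by fun_prop)]
    have key (t : ℝ) : ∫⁻ y : Fin (m + 1) → ℝ,
        f ((Fin.cons t y : Fin (m + 2) → ℝ) 0) * ∏ i : Fin (m + 1),
          ψ ((Fin.cons t y : Fin (m + 2) → ℝ) i.castSucc - (Fin.cons t y : Fin (m + 2) → ℝ) i.succ)
        = f t * ((∫⁻ u, ψ u) * (∫⁻ u, ψ u) ^ m) := by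
      have h := ih (f := fun u => ψ (t - u)) (by fun_prop)
      rw [lintegral_sub_left_eq_self ψ t] at h
      rw [← h, ← lintegral_const_mul _ (by fun_prop)]
      simp [Fin.prod_univ_succ]
    simp_rw [key]
    rw [lintegral_mul_const _ hf, pow_succ']

/-- The integrand `e^{z³/3 - zv}` of the Airy contour integral. -/
noncomputable def airyIntegrand (v : ℝ) (z : ℂ) : ℂ := Complex.exp (z ^ 3 / 3 - z * v)

theorem hasDerivAt_airyIntegrand (v : ℝ) (z : ℂ) :
    HasDerivAt (airyIntegrand v) ((z ^ 2 - v) * airyIntegrand v z) z := by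
  have h : HasDerivAt (fun z : ℂ => z ^ 3 / 3 - z * v) (z ^ 2 - v) z :=
    ((((hasDerivAt_id' z).pow 3).div_const 3).sub ((hasDerivAt_id' z).mul_const (v : ℂ)))
      |>.congr_deriv (by push_cast; ring)
  rw [mul_comm]
  exact h.cexp

theorem continuous_airyIntegrand (v : ℝ) : Continuous (airyIntegrand v) := by
  unfold airyIntegrand
  fun_prop

theorem norm_airyIntegrand (v s t : ℝ) :
    ‖airyIntegrand v (s + t * Complex.I)‖
      = Real.exp (s ^ 3 / 3 - s * v) * Real.exp (-s * t ^ 2) := by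
  rw [airyIntegrand, Complex.norm_exp, ← Real.exp_add]
  congr 1
  have : ((s + t * Complex.I) ^ 3 / 3 - (s + t * Complex.I) * v : ℂ)
      = ((s ^ 3 / 3 - s * v - s * t ^ 2 : ℝ) : ℂ)
        + ((s ^ 2 * t - t ^ 3 / 3 - t * v : ℝ) : ℂ) * Complex.I := by
    push_cast
    linear_combination (s * t ^ 2 + t ^ 3 / 3 * Complex.I) * Complex.I_sq
  rw [this]
  simp only [Complex.add_re, Complex.ofReal_re, Complex.re_ofReal_mul, Complex.I_re]
  ring

theorem integrable_airyIntegrand (v : ℝ) {s : ℝ} (hs : 0 < s) :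
    Integrable fun t : ℝ => airyIntegrand v (s + t * Complex.I) := by
  have hc := continuous_airyIntegrand v
  refine ((integrable_exp_neg_mul_sq hs).const_mul (Real.exp (s ^ 3 / 3 - s * v))).mono'
    (Continuous.aestronglyMeasurable (by fun_prop)) (ae_of_all _ fun t => ?_)
  exact (norm_airyIntegrand v s t).le

theorem hasDerivAt_integral_airyIntegrand (v : ℝ) {s : ℝ} (hs : 0 < s) :
    HasDerivAt (fun σ : ℝ => ∫ t : ℝ, airyIntegrand v (σ + t * Complex.I)) 0 s := by
  have hc := continuous_airyIntegrand v
  set M := (2 * s) ^ 3 / 3 + 2 * s * |v|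
  set bound : ℝ → ℝ := fun t => Real.exp M *
    (((2 * s) ^ 2 + |v|) * Real.exp (-(s / 2) * t ^ 2) + t ^ 2 * Real.exp (-(s / 2) * t ^ 2))
  have hb : Integrable bound := by
    refine Integrable.const_mul (Integrable.add
      ((integrable_exp_neg_mul_sq (by positivity)).const_mul _) ?_) _
    simpa using integrable_rpow_mul_exp_neg_mul_sq (b := s / 2) (by positivity) (s := 2)
      (by norm_num)
  have hbd (t σ : ℝ) (hσ : σ ∈ Set.Ioo (s / 2) (2 * s)) :
      ‖((σ + t * Complex.I) ^ 2 - v) * airyIntegrand v (σ + t * Complex.I)‖ ≤ bound t := by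
    obtain ⟨h1, h2⟩ := hσ
    have h0 : 0 < σ := by linarith
    rw [norm_mul, norm_airyIntegrand]
    have hz : ‖((σ + t * Complex.I) ^ 2 - v : ℂ)‖ ≤ (2 * s) ^ 2 + |v| + t ^ 2 := by
      refine (norm_sub_le _ _).trans ?_
      rw [norm_pow, ← Complex.normSq_eq_norm_sq, Complex.normSq_add_mul_I, Complex.norm_real,
        Real.norm_eq_abs]
      nlinarith
    have he : Real.exp (σ ^ 3 / 3 - σ * v) ≤ Real.exp M := by
      refine Real.exp_le_exp.2 (sub_eq_add_neg (σ ^ 3 / 3) _ ▸ add_le_add ?_ ?_)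
      · gcongr
      · rw [← mul_neg]
        exact mul_le_mul_of_nonneg h2.le (neg_le_abs v) h0.le (abs_nonneg v)
    have hg : Real.exp (-σ * t ^ 2) ≤ Real.exp (-(s / 2) * t ^ 2) := by
      gcongr
    calc _ ≤ ((2 * s) ^ 2 + |v| + t ^ 2) * (Real.exp M * Real.exp (-(s / 2) * t ^ 2)) := by gcongr
      _ = _ := by simp only [bound]; ring
  have hline (t σ : ℝ) : HasDerivAt (fun σ : ℝ => airyIntegrand v (σ + t * Complex.I))
      (((σ + t * Complex.I) ^ 2 - v) * airyIntegrand v (σ + t * Complex.I)) σ := by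
    have h := (hasDerivAt_airyIntegrand v (σ + t * Complex.I)).comp (σ : ℂ)
      ((hasDerivAt_id (σ : ℂ)).add_const (t * Complex.I))
    simpa [Function.comp_def] using h.comp_ofReal
  have hvert (t : ℝ) : HasDerivAt (fun t : ℝ => airyIntegrand v (s + t * Complex.I))
      (((s + t * Complex.I) ^ 2 - v) * airyIntegrand v (s + t * Complex.I) * Complex.I) t := by
    have h := (hasDerivAt_airyIntegrand v (s + t * Complex.I)).comp (t : ℂ)
      (((hasDerivAt_id (t : ℂ)).mul_const Complex.I).const_add (s : ℂ))
    simpa [Function.comp_def] using h.comp_ofReal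
  obtain ⟨hint, hder⟩ := hasDerivAt_integral_of_dominated_loc_of_deriv_le
    (F := fun (σ t : ℝ) => airyIntegrand v (σ + t * Complex.I)) (x₀ := s)
    (Ioo_mem_nhds (by linarith : s / 2 < s) (by linarith : s < 2 * s))
    (.of_forall fun σ => Continuous.aestronglyMeasurable (by fun_prop))
    (integrable_airyIntegrand v hs) (Continuous.aestronglyMeasurable (by fun_prop))
    (ae_of_all _ hbd) hb (ae_of_all _ fun t σ _ => hline t σ)
  have hzero := integral_eq_zero_of_hasDerivAt_of_integrable hvert (hint.mul_const _)
    (integrable_airyIntegrand v hs)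
  rw [integral_mul_const] at hzero
  rwa [(mul_eq_zero.1 hzero).resolve_right Complex.I_ne_zero] at hder

theorem integral_airyIntegrand_eq (v : ℝ) {s s' : ℝ} (hs : 0 < s) (hs' : 0 < s') :
    ∫ t : ℝ, airyIntegrand v (s + t * Complex.I) = ∫ t : ℝ, airyIntegrand v (s' + t * Complex.I) :=
  isOpen_Ioi.is_const_of_deriv_eq_zero (s := Set.Ioi (0 : ℝ))
    (f := fun σ : ℝ => ∫ t : ℝ, airyIntegrand v (σ + t * Complex.I)) isPreconnected_Ioi
    (fun _ hσ => (hasDerivAt_integral_airyIntegrand v hσ).differentiableAt.differentiableWithinAt)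
    (fun _ hσ => (hasDerivAt_integral_airyIntegrand v hσ).deriv) hs hs'

theorem exp_half_lt : Real.exp (1 / 2) < 1.65 := by
  have h : Real.exp (1 / 2) ^ 2 = Real.exp 1 := by rw [← Real.exp_nat_mul]; norm_num
  have := Real.exp_one_lt_d9
  nlinarith [Real.exp_pos (1 / 2)]

theorem exp_half_add_le_pi_mul {y : ℝ} (h₁ : -1 / 8 ≤ y) (h₂ : y ≤ 1 / 8) :
    Real.exp (1 / 2 + 2 * y / 3) ≤ Real.pi * (1 + 4 * y) := by
  have hpi := Real.pi_gt_d2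
  have he : Real.exp (2 * y / 3) * (1 - 2 * y / 3) ≤ 1 := by
    have h := Real.add_one_le_exp (-(2 * y / 3))
    calc _ ≤ Real.exp (2 * y / 3) * Real.exp (-(2 * y / 3)) := by gcongr; linarith
      _ = 1 := by rw [← Real.exp_add]; simp
  have hq : 1.65 ≤ 3.14 * (1 + 4 * y) * (1 - 2 * y / 3) := by nlinarith
  rw [Real.exp_add]
  have hpos : 0 < 1 - 2 * y / 3 := by linarith
  refine le_of_mul_le_mul_right ?_ hpos
  calc Real.exp (1 / 2) * Real.exp (2 * y / 3) * (1 - 2 * y / 3)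
      = Real.exp (1 / 2) * (Real.exp (2 * y / 3) * (1 - 2 * y / 3)) := by ring
    _ ≤ 1.65 * 1 := by gcongr; exact exp_half_lt.le
    _ ≤ 3.14 * (1 + 4 * y) * (1 - 2 * y / 3) := by linarith
    _ ≤ _ := by gcongr; linarith

/-- The Gaussian integral on the line `Re w = r + σ`, normalised, is at most `|σ|`. -/
theorem exp_mul_sqrt_le {r σ : ℝ} (hr : 1 ≤ r) (hσ : 4 * r * σ ^ 2 = 1) :
    Real.exp (r * σ ^ 2 + σ ^ 3 / 3) * (1 / (2 * Real.pi) * √(Real.pi / (r + σ))) ≤ |σ| := by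
  have hσ2 : |σ| ≤ 1 / 2 := abs_le_of_sq_le_sq' (by nlinarith) (by norm_num) |> abs_le.2
  have hσ' := abs_le.1 hσ2
  have hs : 0 < r + σ := by linarith
  have h3 : |σ ^ 3| ≤ 1 / 8 := by
    rw [abs_pow]
    calc |σ| ^ 3 ≤ (1 / 2) ^ 3 := by gcongr
      _ = 1 / 8 := by norm_num
  have h3' := abs_le.1 h3
  have hpi := Real.pi_pos
  have key := exp_half_add_le_pi_mul (y := σ ^ 3) (by linarith) h3'.2
  refine abs_le_of_sq_le_sq' ?_ (abs_nonneg σ) |>.2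
  have hexp : Real.exp (r * σ ^ 2 + σ ^ 3 / 3) ^ 2 = Real.exp (1 / 2 + 2 * σ ^ 3 / 3) := by
    rw [← Real.exp_nat_mul]
    congr 1
    push_cast
    linear_combination hσ / 2
  rw [mul_pow, mul_pow, Real.sq_sqrt (by positivity), hexp, sq_abs]
  have h4 : Real.pi * (1 + 4 * σ ^ 3) = 4 * Real.pi * (r + σ) * σ ^ 2 := by
    linear_combination - Real.pi * hσ
  rw [h4] at key
  calc _ ≤ 4 * Real.pi * (r + σ) * σ ^ 2 * ((1 / (2 * Real.pi)) ^ 2 * (Real.pi / (r + σ))) := by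
        gcongr
    _ = σ ^ 2 := by field_simp; ring

theorem abs_Ai_le (v : ℝ) {s : ℝ} (hs : 0 < s) :
    |Ai v| ≤ Real.exp (s ^ 3 / 3 - s * v) * (1 / (2 * Real.pi) * √(Real.pi / s)) := by
  have hpi := Real.pi_pos
  have hre : ∫ t : ℝ, (Complex.exp ((1 + (t : ℂ) * Complex.I) ^ 3 / 3
      - (1 + (t : ℂ) * Complex.I) * (v : ℂ))).re
      = (∫ t : ℝ, airyIntegrand v (s + t * Complex.I)).re := by
    rw [integral_airyIntegrand_eq v hs one_pos]
    have h := integral_re (integrable_airyIntegrand v one_pos)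
    simpa [airyIntegrand] using h
  rw [Ai, hre, abs_mul, abs_of_pos (by positivity)]
  calc _ ≤ 1 / (2 * Real.pi) * ∫ t : ℝ, ‖airyIntegrand v (s + t * Complex.I)‖ := by
        gcongr
        exact (Complex.abs_re_le_norm _).trans (norm_integral_le_integral_norm _)
    _ = _ := by
        simp_rw [norm_airyIntegrand]
        rw [integral_const_mul, integral_gaussian]
        ring

theorem abs_Ai_add_le {r c η : ℝ} (hr : 1 ≤ r) (hη : 0 < η) (hrη : 4 * r * η ^ 2 = 1) (u : ℝ) :
    |Ai (u + 2 * c)| ≤ Real.exp (r ^ 3 / 3 - 2 * r * c) * Real.exp (-(r * u))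
      * (η * Real.exp (-(η * |u + (2 * c - r ^ 2)|))) := by
  obtain ⟨σ, hσ, hσu⟩ : ∃ σ : ℝ, |σ| = η ∧
      σ * (u + (2 * c - r ^ 2)) = η * |u + (2 * c - r ^ 2)| := by
    rcases le_total 0 (u + (2 * c - r ^ 2)) with h | h
    · exact ⟨η, abs_of_pos hη, by rw [abs_of_nonneg h]⟩
    · exact ⟨-η, by rw [abs_neg, abs_of_pos hη], by rw [abs_of_nonpos h]; ring⟩
  have hσ2 : 4 * r * σ ^ 2 = 1 := by rw [← sq_abs, hσ, hrη]
  have hs : 0 < r + σ := by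
    have := neg_abs_le σ
    nlinarith
  refine (abs_Ai_le _ hs).trans ?_
  have hexp : Real.exp ((r + σ) ^ 3 / 3 - (r + σ) * (u + 2 * c))
      = Real.exp (r ^ 3 / 3 - 2 * r * c) * Real.exp (-(r * u))
        * Real.exp (-(η * |u + (2 * c - r ^ 2)|)) * Real.exp (r * σ ^ 2 + σ ^ 3 / 3) := by
    rw [← Real.exp_add, ← Real.exp_add, ← Real.exp_add, ← hσu]
    congr 1
    ring
  have h := exp_mul_sqrt_le hr hσ2
  rw [hσ] at h
  rw [hexp, mul_assoc]
  refine (mul_le_mul_of_nonneg_left h (by positivity)).trans_eq (by ring)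

theorem measurable_Ai : Measurable Ai := by
  unfold Ai
  refine Measurable.const_mul (StronglyMeasurable.integral_prod_right ?_).measurable _
  exact Continuous.stronglyMeasurable (by unfold Function.uncurry; fun_prop)

theorem lintegral_exp_neg_mul_Ioi {η : ℝ} (hη : 0 < η) :
    ∫⁻ t in Set.Ioi (0 : ℝ), ENNReal.ofReal (Real.exp (-(η * t))) = ENNReal.ofReal (1 / η) := by
  have h := integrableOn_exp_mul_Ioi (neg_neg_of_pos hη) 0
  have h' := integral_exp_mul_Ioi (neg_neg_of_pos hη) 0
  simp only [neg_mul] at h h'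
  rw [← ofReal_integral_eq_lintegral_ofReal h (ae_of_all _ fun _ => (Real.exp_pos _).le), h']
  congr 1
  simp

theorem lintegral_exp_mul_Iic {η : ℝ} (hη : 0 < η) :
    ∫⁻ t in Set.Iic (0 : ℝ), ENNReal.ofReal (Real.exp (η * t)) = ENNReal.ofReal (1 / η) := by
  rw [← ofReal_integral_eq_lintegral_ofReal (integrableOn_exp_mul_Iic hη 0)
    (ae_of_all _ fun _ => (Real.exp_pos _).le), integral_exp_mul_Iic hη]
  simp

theorem lintegral_exp_neg_mul_abs {η : ℝ} (hη : 0 < η) (a : ℝ) :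
    ∫⁻ t, ENNReal.ofReal (η * Real.exp (-(η * |t + a|))) = 2 := by
  rw [lintegral_add_right_eq_self (fun t : ℝ => ENNReal.ofReal (η * Real.exp (-(η * |t|)))) a]
  simp_rw [ENNReal.ofReal_mul hη.le]
  rw [lintegral_const_mul _ (by fun_prop),
    ← lintegral_add_compl _ (measurableSet_Iic (a := (0 : ℝ))), Set.compl_Iic,
    setLIntegral_congr_fun (g := fun t => ENNReal.ofReal (Real.exp (η * t))) measurableSet_Iic
      (fun t ht => by simp only [abs_of_nonpos (show t ≤ 0 from ht), mul_neg, neg_neg]),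
    setLIntegral_congr_fun (g := fun t => ENNReal.ofReal (Real.exp (-(η * t)))) measurableSet_Ioi
      (fun t ht => by simp only [abs_of_pos (show 0 < t from ht)]),
    lintegral_exp_mul_Iic hη, lintegral_exp_neg_mul_Ioi hη, ← ENNReal.ofReal_add (by positivity)
      (by positivity), ← ENNReal.ofReal_mul hη.le]
  have : η * (1 / η + 1 / η) = 2 := by field_simp; norm_num
  rw [this]
  simp

/-- The half-line factors `e^{-η x₀}` and `e^{η x₁}` dominate the cyclic product. -/
theorem prod_abs_Ai_le {m : ℕ} {r c η : ℝ} (hr : 1 ≤ r) (hrc : r ^ 2 ≤ 2 * c) (hη : 0 < η)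
    (hrη : 4 * r * η ^ 2 = 1) (x : Fin (m + 2) → ℝ) :
    ∏ i, |Ai (x i - x (i + 1) + 2 * c)| ≤
      Real.exp (r ^ 3 / 3 - 2 * r * c) ^ (m + 2) * η ^ 2 * (Real.exp (-(η * x 0)) *
        (Real.exp (η * x 1) * ∏ i : Fin m, η * Real.exp
          (-(η * |x i.succ.castSucc - x i.succ.succ + (2 * c - r ^ 2)|)))) := by
  set φ : ℝ → ℝ := fun u => η * Real.exp (-(η * |u + (2 * c - r ^ 2)|))
  have hφ (u : ℝ) : 0 ≤ φ u := by positivity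
  have hsum : ∑ i, -(r * (x i - x (i + 1))) = 0 := by
    have h := Equiv.sum_comp (Equiv.addRight (1 : Fin (m + 2))) x
    simp only [Equiv.coe_addRight] at h
    rw [Finset.sum_neg_distrib, ← Finset.mul_sum, Finset.sum_sub_distrib, h]
    simp
  have hlast : φ (x (Fin.last _) - x 0) ≤ η := by
    refine mul_le_of_le_one_right hη.le (Real.exp_le_one_iff.2 ?_)
    have := abs_nonneg (x (Fin.last _) - x 0 + (2 * c - r ^ 2))
    nlinarith
  have hfirst : φ (x 0 - x 1) ≤ η * (Real.exp (-(η * x 0)) * Real.exp (η * x 1)) := by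
    rw [← Real.exp_add]
    refine mul_le_mul_of_nonneg_left (Real.exp_le_exp.2 ?_) hη.le
    have := le_abs_self (x 0 - x 1 + (2 * c - r ^ 2))
    nlinarith
  calc _ ≤ ∏ i, (Real.exp (r ^ 3 / 3 - 2 * r * c) * Real.exp (-(r * (x i - x (i + 1))))
          * φ (x i - x (i + 1))) :=
        Finset.prod_le_prod (fun _ _ => abs_nonneg _) fun _ _ => abs_Ai_add_le hr hη hrη _
    _ = Real.exp (r ^ 3 / 3 - 2 * r * c) ^ (m + 2) * (φ (x 0 - x 1) *
          (∏ i : Fin m, φ (x i.succ.castSucc - x i.succ.succ)) * φ (x (Fin.last _) - x 0)) := by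
        rw [Finset.prod_mul_distrib, Finset.prod_mul_distrib,
          ← Real.exp_sum _ fun i => -(r * (x i - x (i + 1))), hsum,
          Fin.prod_univ_castSucc (fun i => φ (x i - x (i + 1))),
          Fin.last_add_one]
        simp_rw [Fin.coeSucc_eq_succ]
        rw [Fin.prod_univ_succ (fun i : Fin (m + 1) => φ (x i.castSucc - x i.succ))]
        simp
    _ ≤ Real.exp (r ^ 3 / 3 - 2 * r * c) ^ (m + 2) *
          (η * (Real.exp (-(η * x 0)) * Real.exp (η * x 1)) *
          (∏ i : Fin m, φ (x i.succ.castSucc - x i.succ.succ)) * η) := by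
        have hp : 0 ≤ ∏ i : Fin m, φ (x i.succ.castSucc - x i.succ.succ) :=
          Finset.prod_nonneg fun _ _ => hφ _
        have := hφ (x (Fin.last _) - x 0)
        gcongr
    _ = _ := by ring

theorem setLIntegral_prod_Ai_le {m : ℕ} {r c : ℝ} (hr : 1 ≤ r) (hrc : r ^ 2 ≤ 2 * c) :
    ∫⁻ x in Set.univ.pi fun i : Fin (m + 2) => if i = 0 then Set.Ioi (0 : ℝ) else Set.Iic (0 : ℝ),
      ‖∏ i, Ai (x i - x (i + 1) + 2 * c)‖ₑ ≤
        ENNReal.ofReal ((2 * Real.exp (r ^ 3 / 3 - 2 * r * c)) ^ (m + 2)) := by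
  obtain ⟨η, hη, hrη⟩ : ∃ η : ℝ, 0 < η ∧ 4 * r * η ^ 2 = 1 := by
    refine ⟨1 / (2 * √r), by positivity, ?_⟩
    rw [div_pow, mul_pow, Real.sq_sqrt (by positivity)]
    field_simp
    norm_num
  set ψ : ℝ → ENNReal := fun u => ENNReal.ofReal (η * Real.exp (-(η * |u + (2 * c - r ^ 2)|)))
    with hψ
  have hψm : Measurable ψ := by fun_prop
  set A : ℝ → ENNReal := (Set.Ioi 0).indicator fun t => ENNReal.ofReal (Real.exp (-(η * t)))
  set B : ℝ → ENNReal := (Set.Iic 0).indicator fun t => ENNReal.ofReal (Real.exp (η * t))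
  have hA : Measurable A := Measurable.indicator (by fun_prop) measurableSet_Ioi
  have hB : Measurable B := Measurable.indicator (by fun_prop) measurableSet_Iic
  set G := Real.exp (r ^ 3 / 3 - 2 * r * c)
  have hS : MeasurableSet (Set.univ.pi fun i : Fin (m + 2) =>
      if i = 0 then Set.Ioi (0 : ℝ) else Set.Iic (0 : ℝ)) :=
    MeasurableSet.univ_pi fun i => by split_ifs <;> measurability
  have hmeas : Measurable fun x : Fin (m + 2) → ℝ =>
      A (x 0) * (B (x 1) * ∏ i : Fin m, ψ (x i.succ.castSucc - x i.succ.succ)) := by fun_prop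
  calc _ ≤ ∫⁻ x in Set.univ.pi fun i : Fin (m + 2) =>
          if i = 0 then Set.Ioi (0 : ℝ) else Set.Iic (0 : ℝ), ENNReal.ofReal (G ^ (m + 2) * η ^ 2) *
          (A (x 0) * (B (x 1) * ∏ i : Fin m, ψ (x i.succ.castSucc - x i.succ.succ))) := by
        refine setLIntegral_mono' hS fun x hx => ?_
        have h0 : x 0 ∈ Set.Ioi (0 : ℝ) := by simpa using hx 0 trivial
        have h1 : x 1 ∈ Set.Iic (0 : ℝ) := by simpa using hx 1 trivial
        simp only [A, B, Set.indicator_of_mem h0, Set.indicator_of_mem h1, hψ]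
        rw [← ENNReal.ofReal_prod_of_nonneg fun _ _ => by positivity,
          ← ENNReal.ofReal_mul (by positivity), ← ENNReal.ofReal_mul (by positivity),
          ← ENNReal.ofReal_mul (by positivity), ← ofReal_norm, norm_prod]
        exact ENNReal.ofReal_le_ofReal (prod_abs_Ai_le hr hrc hη hrη x)
    _ ≤ ∫⁻ x : Fin (m + 2) → ℝ, ENNReal.ofReal (G ^ (m + 2) * η ^ 2) *
          (A (x 0) * (B (x 1) * ∏ i : Fin m, ψ (x i.succ.castSucc - x i.succ.succ))) :=
        setLIntegral_le_lintegral _ _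
    _ = ENNReal.ofReal (G ^ (m + 2) * η ^ 2) * (ENNReal.ofReal (1 / η) *
          (ENNReal.ofReal (1 / η) * 2 ^ m)) := by
        rw [lintegral_const_mul _ hmeas, lintegral_pi_fin_succ hmeas]
        have h := lintegral_chain hB hψm m
        rw [lintegral_indicator measurableSet_Iic, lintegral_exp_mul_Iic hη,
          lintegral_exp_neg_mul_abs hη] at h
        have hin (t : ℝ) : ∫⁻ y : Fin (m + 1) → ℝ, A ((Fin.cons t y : Fin (m + 2) → ℝ) 0) *
            (B ((Fin.cons t y : Fin (m + 2) → ℝ) 1) * ∏ i : Fin m,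
              ψ ((Fin.cons t y : Fin (m + 2) → ℝ) i.succ.castSucc
                - (Fin.cons t y : Fin (m + 2) → ℝ) i.succ.succ))
            = A t * (ENNReal.ofReal (1 / η) * 2 ^ m) := by
          rw [← h, ← lintegral_const_mul _ (by fun_prop)]
          simp only [Fin.cons_zero, Fin.cons_one, Fin.castSucc_succ, Fin.cons_succ]
        simp_rw [hin]
        rw [lintegral_mul_const _ hA, lintegral_indicator measurableSet_Ioi,
          lintegral_exp_neg_mul_Ioi hη]
    _ ≤ _ := by
        rw [← ENNReal.ofReal_ofNat 2, ← ENNReal.ofReal_pow (by norm_num),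
          ← ENNReal.ofReal_mul (by positivity), ← ENNReal.ofReal_mul (by positivity),
          ← ENNReal.ofReal_mul (by positivity)]
        refine ENNReal.ofReal_le_ofReal ?_
        have h2 : G ^ (m + 2) * η ^ 2 * (1 / η * (1 / η * 2 ^ m)) = 2 ^ m * G ^ (m + 2) := by
          field_simp
        rw [h2, mul_pow]
        gcongr
        · norm_num
        · omega

/-- The trace of `P₀ B̂ (P̄₀ B̂)^{n-1}`: the cyclic integral (with `x_{n+1} = x_1`) of
`∏ Ai(x_i - x_{i+1} + 2c)` over `x_1 ∈ (0,∞)`, `x_2,…,x_n ∈ (-∞,0]` is absolutely convergent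
and bounded in absolute value by `β^n`. -/
theorem trace_P0Bhat_pow (n : ℕ) [NeZero n] (hn : 2 ≤ n) (r c : ℝ)
    (hr : 1 ≤ r) (hrc : r ^ 2 ≤ 2 * c) :
    IntegrableOn (fun x : Fin n → ℝ => ∏ i : Fin n, Ai (x i - x (i + 1) + 2 * c))
      (Set.univ.pi fun i : Fin n => if i = 0 then Set.Ioi (0 : ℝ) else Set.Iic (0 : ℝ)) ∧
    |∫ x in Set.univ.pi fun i : Fin n => if i = 0 then Set.Ioi (0 : ℝ) else Set.Iic (0 : ℝ),
        ∏ i : Fin n, Ai (x i - x (i + 1) + 2 * c)| ≤ beta r c ^ n := by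
  obtain ⟨m, rfl⟩ := Nat.exists_eq_add_of_le' hn
  have hle := setLIntegral_prod_Ai_le (m := m) hr hrc
  have hAi := measurable_Ai
  refine ⟨⟨Measurable.aestronglyMeasurable (by fun_prop), hle.trans_lt ENNReal.ofReal_lt_top⟩, ?_⟩
  refine le_trans ?_ (pow_le_pow_left₀ (by positivity) (le_max_left _ _) _)
  rw [← ENNReal.ofReal_le_ofReal_iff (by positivity), ← Real.enorm_eq_ofReal_abs]
  exact (enorm_integral_le_lintegral_enorm _).trans hle
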